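/- Assume either λ₁ = λ₂ = 0 and δ ≥ 1, or max(λ₁,λ₂) > 0, and let (τ*, β*) be the unique strictly positive solution of the fixed-point system. Then at the saddle point, ψ(τ*, β*) = (β*)²/4 + λ₂·E[(prox(τ̃*H; λ₁τ̃*/β*))²] + λ₁·E[|prox(τ̃*H; λ₁τ̃*/β*)|], where τ̃* = 1/(1/τ* + 2λ₂/β*) and H ~ N(0,1). -/

import Mathlib

open MeasureTheory ProbabilityTheory Real Filter Topology

noncomputable section

/-- The proximal operator `prox(y; t)` with box constraint `|x| ≤ √P`. -/
def prox (P y t : ℝ) : ℝ :=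
  if t + Real.sqrt P ≤ y then Real.sqrt P
  else if t ≤ y then y - t
  else if -t ≤ y then 0
  else if -t - Real.sqrt P ≤ y then y + t
  else -Real.sqrt P

/-- Expectation with respect to a standard Gaussian random variable. -/
def gaussExp (f : ℝ → ℝ) : ℝ := ∫ h, f h ∂(gaussianReal 0 1)

/-- `τ̃ = 1/(1/τ + 2λ₂/β)`. -/
def tauTilde (lam2 τ β : ℝ) : ℝ := 1 / (1 / τ + 2 * lam2 / β)

/-- The fixed-point system characterizing `(τ*, β*)`. -/
def FixedPoint (δ ρ P lam1 lam2 τ β : ℝ) : Prop :=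
  τ ^ 2 * δ = ρ + gaussExp (fun h =>
      (prox P (tauTilde lam2 τ β * h) (lam1 * tauTilde lam2 τ β / β)) ^ 2) ∧
  β = 2 * τ * δ - 2 * gaussExp (fun h =>
      h * prox P (tauTilde lam2 τ β * h) (lam1 * tauTilde lam2 τ β / β))

/-- `ψ(τ, β)`. -/
def psi (δ ρ P lam1 lam2 τ β : ℝ) : ℝ :=
  β * τ * δ / 2 - β ^ 2 / 4 + β * ρ / (2 * τ) +
    gaussExp (fun h => sInf ((fun x => β / (2 * τ) * x ^ 2 + lam2 * x ^ 2 - β * h * x + lam1 * |x|) ''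
      Set.Icc (-Real.sqrt P) (Real.sqrt P)))

/-- The inner minimum value `min_{τ > 0} ψ(τ, β)`. -/
def minVal (δ ρ P lam1 lam2 β : ℝ) : ℝ :=
  sInf ((fun τ => psi δ ρ P lam1 lam2 τ β) '' Set.Ioi 0)

end

noncomputable section

/-- `prox` takes values in the box. -/
lemma abs_prox_le (P y t : ℝ) : |prox P y t| ≤ √P := by
  have hs := Real.sqrt_nonneg P
  unfold prox
  rw [abs_le]
  split_ifs <;> constructor <;> linarith

/-- `prox P y t` minimizes `x ↦ x² / 2 - y x + t |x|` over the box. -/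
lemma prox_objective_le (P y : ℝ) {t x : ℝ} (ht : 0 ≤ t) (hx : |x| ≤ √P) :
    prox P y t ^ 2 / 2 - y * prox P y t + t * |prox P y t| ≤ x ^ 2 / 2 - y * x + t * |x| := by
  have hs := Real.sqrt_nonneg P
  obtain ⟨hx₁, hx₂⟩ := abs_le.mp hx
  have hle : t * x ≤ t * |x| := mul_le_mul_of_nonneg_left (le_abs_self x) ht
  have hge : t * (-x) ≤ t * |x| := mul_le_mul_of_nonneg_left (neg_le_abs x) ht
  unfold prox
  split_ifs with h₁ h₂ h₃ h₄
  · rw [abs_of_nonneg hs]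
    nlinarith [mul_nonneg (sub_nonneg.2 hx₂) (sub_nonneg.2 h₁), sq_nonneg (√P - x)]
  · rw [abs_of_nonneg (sub_nonneg.2 h₂)]
    nlinarith [sq_nonneg (x - (y - t))]
  · have hy : y * x ≤ t * |x| :=
      calc y * x ≤ |y * x| := le_abs_self _
        _ = |y| * |x| := abs_mul y x
        _ ≤ t * |x| :=
          mul_le_mul_of_nonneg_right (abs_le.2 ⟨h₃, (not_le.1 h₂).le⟩) (abs_nonneg x)
    simp only [abs_zero]
    nlinarith [sq_nonneg x]
  · rw [abs_of_nonpos (by linarith)]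
    nlinarith [sq_nonneg (x - (y + t))]
  · rw [abs_neg, abs_of_nonneg hs]
    have h : 0 ≤ -t - √P - y := by linarith
    nlinarith [mul_nonneg (by linarith : 0 ≤ x + √P) h, sq_nonneg (√P + x)]

lemma measurable_prox (P t : ℝ) : Measurable fun y => prox P y t := by
  unfold prox
  refine Measurable.ite measurableSet_Ici measurable_const ?_
  refine Measurable.ite measurableSet_Ici (by fun_prop) ?_
  refine Measurable.ite measurableSet_Ici measurable_const ?_
  exact Measurable.ite measurableSet_Ici (by fun_prop) measurable_const

/-- The inner minimum in `psi` is attained at the proximal point. -/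
lemma sInf_objective_eq (P h : ℝ) {lam1 lam2 τ β : ℝ} (hl1 : 0 ≤ lam1) (hl2 : 0 ≤ lam2)
    (hτ : 0 < τ) (hβ : 0 < β) :
    sInf ((fun x => β / (2 * τ) * x ^ 2 + lam2 * x ^ 2 - β * h * x + lam1 * |x|) ''
      Set.Icc (-√P) (√P)) =
      (β / (2 * τ) + lam2) *
          prox P (tauTilde lam2 τ β * h) (lam1 * tauTilde lam2 τ β / β) ^ 2 -
        β * (h * prox P (tauTilde lam2 τ β * h) (lam1 * tauTilde lam2 τ β / β)) +
        lam1 * |prox P (tauTilde lam2 τ β * h) (lam1 * tauTilde lam2 τ β / β)| := by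
  have hT : 0 < tauTilde lam2 τ β := by unfold tauTilde; positivity
  have hcoef : β / (2 * tauTilde lam2 τ β) = β / (2 * τ) + lam2 := by
    unfold tauTilde
    field_simp
  set T := tauTilde lam2 τ β
  have hscale (x : ℝ) : β / (2 * τ) * x ^ 2 + lam2 * x ^ 2 - β * h * x + lam1 * |x| =
      β / T * (x ^ 2 / 2 - T * h * x + lam1 * T / β * |x|) := by
    rw [← add_mul, ← hcoef]
    field_simp
  have hmem : prox P (T * h) (lam1 * T / β) ∈ Set.Icc (-√P) (√P) :=
    abs_le.1 (abs_prox_le P _ _)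
  have hleast : IsLeast ((fun x => β / (2 * τ) * x ^ 2 + lam2 * x ^ 2 - β * h * x + lam1 * |x|) ''
      Set.Icc (-√P) (√P))
      (β / (2 * τ) * prox P (T * h) (lam1 * T / β) ^ 2 +
        lam2 * prox P (T * h) (lam1 * T / β) ^ 2 - β * h * prox P (T * h) (lam1 * T / β) +
        lam1 * |prox P (T * h) (lam1 * T / β)|) := by
    refine ⟨⟨_, hmem, rfl⟩, ?_⟩
    rintro _ ⟨x, hx, rfl⟩
    simp only [hscale]
    exact mul_le_mul_of_nonneg_left
      (prox_objective_le P (T * h) (by positivity) (abs_le.2 hx)) (by positivity)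
  rw [hleast.csInf_eq]
  ring

theorem psi_at_saddle_point
    (δ ρ P lam1 lam2 τs βs : ℝ) (hδ : 0 < δ) (hρ : 0 < ρ) (hP : 0 < P)
    (hl1 : 0 ≤ lam1) (hl2 : 0 ≤ lam2)
    (hcase : 0 < max lam1 lam2 ∨ (lam1 = 0 ∧ lam2 = 0 ∧ 1 ≤ δ))
    (hτs : 0 < τs) (hβs : 0 < βs)
    (hfix : FixedPoint δ ρ P lam1 lam2 τs βs)
    (huniq : ∀ τ β : ℝ, 0 < τ → 0 < β → FixedPoint δ ρ P lam1 lam2 τ β → τ = τs ∧ β = βs) :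
    psi δ ρ P lam1 lam2 τs βs =
      βs ^ 2 / 4 +
        lam2 * gaussExp (fun h =>
          (prox P (tauTilde lam2 τs βs * h) (lam1 * tauTilde lam2 τs βs / βs)) ^ 2) +
        lam1 * gaussExp (fun h =>
          |prox P (tauTilde lam2 τs βs * h) (lam1 * tauTilde lam2 τs βs / βs)|) := by
  obtain ⟨hA, hB⟩ := hfix
  unfold psi
  simp only [sInf_objective_eq P _ hl1 hl2 hτs hβs]
  set T := tauTilde lam2 τs βs
  set p : ℝ → ℝ := fun h => prox P (T * h) (lam1 * T / βs)
  have hpm : Measurable p := (measurable_prox P _).comp (measurable_const_mul T)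
  have hpb (h : ℝ) : |p h| ≤ √P := abs_prox_le P _ _
  have hp : Integrable p (gaussianReal 0 1) :=
    .of_bound hpm.aestronglyMeasurable (√P) (ae_of_all _ hpb)
  have hp2 : Integrable (fun h => p h ^ 2) (gaussianReal 0 1) := by
    simpa only [sq] using hp.mul_bdd hpm.aestronglyMeasurable (ae_of_all _ hpb)
  have hid : Integrable (fun h : ℝ => h) (gaussianReal 0 1) :=
    (memLp_id_gaussianReal 1).integrable le_rfl
  have hhp : Integrable (fun h => h * p h) (gaussianReal 0 1) :=
    hid.mul_bdd hpm.aestronglyMeasurable (ae_of_all _ hpb)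
  have hsplit : gaussExp (fun h =>
      (βs / (2 * τs) + lam2) * p h ^ 2 - βs * (h * p h) + lam1 * |p h|) =
      (βs / (2 * τs) + lam2) * gaussExp (fun h => p h ^ 2) -
        βs * gaussExp (fun h => h * p h) + lam1 * gaussExp (fun h => |p h|) := by
    simp only [gaussExp]
    have hsub : Integrable (fun h => (βs / (2 * τs) + lam2) * p h ^ 2 - βs * (h * p h))
        (gaussianReal 0 1) := (hp2.const_mul _).sub (hhp.const_mul _)
    rw [integral_add hsub (hp.abs.const_mul _),
      integral_sub (hp2.const_mul _) (hhp.const_mul _)]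
    simp only [integral_const_mul]
  change τs ^ 2 * δ = ρ + gaussExp (fun h => p h ^ 2) at hA
  change βs = 2 * τs * δ - 2 * gaussExp (fun h => h * p h) at hB
  change _ + gaussExp (fun h =>
    (βs / (2 * τs) + lam2) * p h ^ 2 - βs * (h * p h) + lam1 * |p h|) =
    _ + lam2 * gaussExp (fun h => p h ^ 2) + lam1 * gaussExp (fun h => |p h|)
  rw [hsplit]
  have hquad : βs * ρ / (2 * τs) + βs / (2 * τs) * gaussExp (fun h => p h ^ 2) =
      βs * τs * δ / 2 := by
    field_simp
    linarith
  linear_combination hquad - βs / 2 * hB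

end
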